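/- arXiv:math-ph/0311001 — 3 statements merged into one kernel-verified Lean document; each statement's English description precedes it below -/
import Mathlib

section
/- Let Q₁₃ be the Minkowski quadratic form on ℝ⁴ defined by Q₁₃(x) = x₀² − x₁² − x₂² − x₃², and let Q₃₀ be the positive definite quadratic form on ℝ³ defined by Q₃₀(x) = x₁² + x₂² + x₃². Then the Pauli algebra CliffordAlgebra Q₃₀ is isomorphic as an ℝ-algebra to the even subalgebra of the spacetime algebra CliffordAlgebra Q₁₃. -/
/-- The Minkowski quadratic form on `ℝ⁴`: `Q₁₃ x = x₀² − x₁² − x₂² − x₃²`. -/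
noncomputable def Q13 : QuadraticForm ℝ (Fin 4 → ℝ) :=
  QuadraticMap.weightedSumSquares ℝ ![(1 : ℝ), -1, -1, -1]

/-- The positive definite quadratic form on `ℝ³`: `Q₃₀ x = x₁² + x₂² + x₃²`. -/
noncomputable def Q30 : QuadraticForm ℝ (Fin 3 → ℝ) :=
  QuadraticMap.weightedSumSquares ℝ ![(1 : ℝ), 1, 1]

/-- Functoriality of the even subalgebra along isometries. -/
noncomputable def evenMapAux {M N : Type} [AddCommGroup M] [Module ℝ M] [AddCommGroup N]
    [Module ℝ N] (Q₁ : QuadraticForm ℝ M) (Q₂ : QuadraticForm ℝ N) (f : M →ₗ[ℝ] N)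
    (h : ∀ m, Q₂ (f m) = Q₁ m) :
    CliffordAlgebra.even Q₁ →ₐ[ℝ] CliffordAlgebra.even Q₂ :=
  CliffordAlgebra.even.lift Q₁
    { bilin := (CliffordAlgebra.even.ι Q₂).bilin.compl₁₂ f f
      contract := fun m => by
        rw [LinearMap.compl₁₂_apply, CliffordAlgebra.EvenHom.contract, h]
      contract_mid := fun m₁ m₂ m₃ => by
        simp only [LinearMap.compl₁₂_apply]
        rw [CliffordAlgebra.EvenHom.contract_mid, h] }

theorem evenMapAux_ι {M N : Type} [AddCommGroup M] [Module ℝ M] [AddCommGroup N]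
    [Module ℝ N] (Q₁ : QuadraticForm ℝ M) (Q₂ : QuadraticForm ℝ N) (f : M →ₗ[ℝ] N)
    (h : ∀ m, Q₂ (f m) = Q₁ m) (x y : M) :
    evenMapAux Q₁ Q₂ f h ((CliffordAlgebra.even.ι Q₁).bilin x y) =
      (CliffordAlgebra.even.ι Q₂).bilin (f x) (f y) :=
  CliffordAlgebra.even.lift_ι _ _ x y

theorem evenMapAux_comp {M N : Type} [AddCommGroup M] [Module ℝ M] [AddCommGroup N]
    [Module ℝ N] (Q₁ : QuadraticForm ℝ M) (Q₂ : QuadraticForm ℝ N) (f : M →ₗ[ℝ] N)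
    (h : ∀ m, Q₂ (f m) = Q₁ m) (g : N →ₗ[ℝ] M) (h' : ∀ m, Q₁ (g m) = Q₂ m)
    (hgf : ∀ m, g (f m) = m) :
    (evenMapAux Q₂ Q₁ g h').comp (evenMapAux Q₁ Q₂ f h) = AlgHom.id ℝ _ := by
  apply CliffordAlgebra.even.algHom_ext
  apply CliffordAlgebra.EvenHom.ext
  refine LinearMap.ext fun x => LinearMap.ext fun y => ?_
  change evenMapAux Q₂ Q₁ g h' (evenMapAux Q₁ Q₂ f h ((CliffordAlgebra.even.ι Q₁).bilin x y)) =
    (CliffordAlgebra.even.ι Q₁).bilin x y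
  rw [evenMapAux_ι, evenMapAux_ι, hgf, hgf]

/-- The linear equivalence moving the last coordinate to the time coordinate. -/
def spacetimeSplit : ((Fin 3 → ℝ) × ℝ) ≃ₗ[ℝ] (Fin 4 → ℝ) where
  toFun p := ![p.2, p.1 0, p.1 1, p.1 2]
  invFun x := (![x 1, x 2, x 3], x 0)
  map_add' p q := by ext i; fin_cases i <;> simp
  map_smul' r p := by ext i; fin_cases i <;> simp
  left_inv p := by
    refine Prod.ext ?_ rfl
    ext i; fin_cases i <;> simp
  right_inv x := by ext i; fin_cases i <;> simp

theorem spacetimeSplit_form (p : (Fin 3 → ℝ) × ℝ) :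
    Q13 (spacetimeSplit p) = (-(CliffordAlgebra.EquivEven.Q' Q30)) p := by
  rw [neg_apply, CliffordAlgebra.EquivEven.Q'_apply]
  simp [Q13, Q30, QuadraticMap.weightedSumSquares_apply, spacetimeSplit, Fin.sum_univ_succ]
  ring

/-- The Pauli algebra `Cl(3,0)` is isomorphic as an `ℝ`-algebra to the even subalgebra
of the spacetime algebra `Cl(1,3)`. -/
theorem pauli_iso_even_spacetime :
    Nonempty (CliffordAlgebra Q30 ≃ₐ[ℝ] CliffordAlgebra.even Q13) := by
  have h' : ∀ x, (-(CliffordAlgebra.EquivEven.Q' Q30)) (spacetimeSplit.symm x) = Q13 x := by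
    intro x
    rw [← spacetimeSplit_form, LinearEquiv.apply_symm_apply]
  exact ⟨((CliffordAlgebra.equivEven Q30).trans (CliffordAlgebra.evenEquivEvenNeg _)).trans
    (AlgEquiv.ofAlgHom
      (evenMapAux _ Q13 spacetimeSplit.toLinearMap spacetimeSplit_form)
      (evenMapAux Q13 _ spacetimeSplit.symm.toLinearMap h')
      (evenMapAux_comp _ _ _ _ _ _ (fun m => spacetimeSplit.apply_symm_apply m))
      (evenMapAux_comp _ _ _ _ _ _ (fun m => spacetimeSplit.symm_apply_apply m)))⟩
end

section
/- Let Q₁₃ be the Minkowski quadratic form on ℝ⁴ defined by Q₁₃(x) = x₀² − x₁² − x₂² − x₃². Then the spacetime algebra CliffordAlgebra Q₁₃ is isomorphic as an ℝ-algebra to the algebra of 2×2 matrices over the quaternions, Matrix (Fin 2) (Fin 2) ℍ. -/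
open scoped Quaternion

namespace SpacetimeAux

/-- Adjoin left multiples by `e` to a submodule. -/
noncomputable def step {A : Type*} [Ring A] [Algebra ℝ A] (e : A) (P : Submodule ℝ A) :
    Submodule ℝ A := P ⊔ P.map (LinearMap.mulLeft ℝ e)

lemma le_step {A : Type*} [Ring A] [Algebra ℝ A] (e : A) (P : Submodule ℝ A) :
    P ≤ step e P := le_sup_left

lemma step_finite {A : Type*} [Ring A] [Algebra ℝ A] (e : A) (P : Submodule ℝ A)
    [FiniteDimensional ℝ P] : FiniteDimensional ℝ (step e P) := by
  unfold step; infer_instance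

lemma step_finrank {A : Type*} [Ring A] [Algebra ℝ A] (e : A) (P : Submodule ℝ A)
    [FiniteDimensional ℝ P] (n : ℕ) (h : Module.finrank ℝ P ≤ n) :
    Module.finrank ℝ (step e P) ≤ 2 * n := by
  have h1 := Submodule.finrank_add_le_finrank_add_finrank P (P.map (LinearMap.mulLeft ℝ e))
  have h2 := Submodule.finrank_map_le (LinearMap.mulLeft ℝ e) P
  unfold step
  omega

lemma step_closed_self {A : Type*} [Ring A] [Algebra ℝ A] (e : A) (P : Submodule ℝ A) (c : ℝ)
    (he : e * e = algebraMap ℝ A c) : ∀ x ∈ step e P, e * x ∈ step e P := by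
  intro x hx
  obtain ⟨p, hp, q, hq, rfl⟩ := Submodule.mem_sup.1 hx
  obtain ⟨r, hr, rfl⟩ := hq
  rw [mul_add]
  refine add_mem (Submodule.mem_sup_right ⟨p, hp, rfl⟩) (Submodule.mem_sup_left ?_)
  rw [LinearMap.mulLeft_apply, ← mul_assoc, he, ← Algebra.smul_def]
  exact P.smul_mem _ hr

lemma step_closed_other {A : Type*} [Ring A] [Algebra ℝ A] (e y : A) (P : Submodule ℝ A)
    (he : y * e = - (e * y)) (hP : ∀ x ∈ P, y * x ∈ P) :
    ∀ x ∈ step e P, y * x ∈ step e P := by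
  intro x hx
  obtain ⟨p, hp, q, hq, rfl⟩ := Submodule.mem_sup.1 hx
  obtain ⟨r, hr, rfl⟩ := hq
  rw [mul_add]
  refine add_mem (Submodule.mem_sup_left (hP _ hp)) (Submodule.mem_sup_right ?_)
  rw [LinearMap.mulLeft_apply, ← mul_assoc, he, neg_mul, mul_assoc]
  exact neg_mem ⟨_, hP _ hr, rfl⟩

/-- The generators of the spacetime algebra. -/
noncomputable def e (i : Fin 4) : CliffordAlgebra Q13 := CliffordAlgebra.ι Q13 (Pi.single i 1)

lemma e_sq (i : Fin 4) : e i * e i = algebraMap ℝ _ (Q13 (Pi.single i 1)) :=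
  CliffordAlgebra.ι_sq_scalar _ _

lemma e_anti (i j : Fin 4) (h : i ≠ j) : e i * e j = - (e j * e i) := by
  rw [eq_neg_iff_add_eq_zero]
  unfold e
  rw [CliffordAlgebra.ι_mul_ι_add_swap]
  suffices hp : QuadraticMap.polar Q13 (Pi.single i 1) (Pi.single j 1) = 0 by
    rw [hp, map_zero]
  fin_cases i <;> fin_cases j <;> first | exact absurd rfl h |
    simp [QuadraticMap.polar, Q13, QuadraticMap.weightedSumSquares_apply, Fin.sum_univ_four,
      Pi.single_apply]

/-- The full span of ordered monomials. -/
noncomputable def S : Submodule ℝ (CliffordAlgebra Q13) :=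
  step (e 0) (step (e 1) (step (e 2) (step (e 3) (Submodule.span ℝ {1}))))

lemma S_closed (i : Fin 4) : ∀ x ∈ S, e i * x ∈ S := by
  have h3 := step_closed_self (e 3) (Submodule.span ℝ {1}) _ (e_sq 3)
  have h2 := step_closed_self (e 2) (step (e 3) (Submodule.span ℝ {1})) _ (e_sq 2)
  have h1 := step_closed_self (e 1) (step (e 2) (step (e 3) (Submodule.span ℝ {1}))) _ (e_sq 1)
  fin_cases i
  · exact step_closed_self _ _ _ (e_sq 0)
  · exact step_closed_other _ _ _ (e_anti _ _ (by decide)) h1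
  · exact step_closed_other _ _ _ (e_anti _ _ (by decide))
      (step_closed_other _ _ _ (e_anti _ _ (by decide)) h2)
  · exact step_closed_other _ _ _ (e_anti _ _ (by decide))
      (step_closed_other _ _ _ (e_anti _ _ (by decide))
        (step_closed_other _ _ _ (e_anti _ _ (by decide)) h3))

lemma one_mem_S : (1 : CliffordAlgebra Q13) ∈ S :=
  le_step _ _ (le_step _ _ (le_step _ _ (le_step _ _ (Submodule.mem_span_singleton_self 1))))

lemma ι_eq (v : Fin 4 → ℝ) : CliffordAlgebra.ι Q13 v = ∑ i, v i • e i := by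
  conv_lhs => rw [pi_eq_sum_univ' v]
  simp only [map_sum, map_smul]
  refine Finset.sum_congr rfl fun i _ => ?_
  unfold e
  congr 2

lemma S_top : S = ⊤ := by
  rw [eq_top_iff]
  intro x _
  induction x using CliffordAlgebra.left_induction with
  | algebraMap r => rw [Algebra.algebraMap_eq_smul_one]; exact S.smul_mem _ one_mem_S
  | add x y hx hy => exact add_mem (hx trivial) (hy trivial)
  | ι_mul x m hx =>
    rw [ι_eq, Finset.sum_mul]
    refine sum_mem fun i _ => ?_
    rw [smul_mul_assoc]
    exact S.smul_mem _ (S_closed i _ (hx trivial))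

lemma S_dim : FiniteDimensional ℝ S ∧ Module.finrank ℝ S ≤ 16 := by
  have h0 : Module.finrank ℝ (Submodule.span ℝ {(1 : CliffordAlgebra Q13)}) ≤ 1 := by
    simpa using finrank_span_le_card (R := ℝ) ({1} : Set (CliffordAlgebra Q13))
  have f3 := step_finite (e 3) (Submodule.span ℝ {1})
  have f2 := step_finite (e 2) (step (e 3) (Submodule.span ℝ {1}))
  have f1 := step_finite (e 1) (step (e 2) (step (e 3) (Submodule.span ℝ {1})))
  exact ⟨step_finite _ _, step_finrank _ _ 8 (step_finrank _ _ 4 (step_finrank _ _ 2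
    (step_finrank _ _ 1 h0)))⟩

/-- A quaternion from its coordinates. -/
def mkq (a b c d : ℝ) : ℍ[ℝ] := ⟨a, b, c, d⟩

@[simp] lemma mkq_re (a b c d : ℝ) : (mkq a b c d).re = a := rfl
@[simp] lemma mkq_imI (a b c d : ℝ) : (mkq a b c d).imI = b := rfl
@[simp] lemma mkq_imJ (a b c d : ℝ) : (mkq a b c d).imJ = c := rfl
@[simp] lemma mkq_imK (a b c d : ℝ) : (mkq a b c d).imK = d := rfl

/-- The Dirac-type matrix associated with a vector. -/
noncomputable def gam (v : Fin 4 → ℝ) : Matrix (Fin 2) (Fin 2) ℍ[ℝ] :=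
  !![mkq (v 0) 0 0 0, mkq (v 1) (v 2) (v 3) 0; mkq (-v 1) (v 2) (v 3) 0, mkq (-v 0) 0 0 0]

/-- `gam` as a linear map. -/
noncomputable def gamL : (Fin 4 → ℝ) →ₗ[ℝ] Matrix (Fin 2) (Fin 2) ℍ[ℝ] where
  toFun := gam
  map_add' u v := by
    ext i j <;> fin_cases i <;> fin_cases j <;> simp [gam] <;> ring
  map_smul' c v := by
    ext i j <;> fin_cases i <;> fin_cases j <;> simp [gam]

lemma gam_sq (v : Fin 4 → ℝ) : gamL v * gamL v = algebraMap ℝ _ (Q13 v) := by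
  ext i j <;> fin_cases i <;> fin_cases j <;>
    simp [gamL, gam, Matrix.mul_apply, Matrix.algebraMap_matrix_apply, Q13,
      QuadraticMap.weightedSumSquares_apply, Fin.sum_univ_four] <;> ring

/-- The algebra homomorphism. -/
noncomputable def φ : CliffordAlgebra Q13 →ₐ[ℝ] Matrix (Fin 2) (Fin 2) ℍ[ℝ] :=
  CliffordAlgebra.lift Q13 ⟨gamL, gam_sq⟩

lemma φ_surj : Function.Surjective φ := by
  rw [← AlgHom.range_eq_top, eq_top_iff]
  intro M _
  set R := φ.range
  have hg : ∀ v, gam v ∈ R := fun v => ⟨CliffordAlgebra.ι Q13 v, by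
    exact CliffordAlgebra.lift_ι_apply _ _ _⟩
  have h11 : !![1, 0; 0, 0] ∈ R := by
    convert R.smul_mem (add_mem R.one_mem (hg ![1, 0, 0, 0])) (1 / 2 : ℝ) using 1
    ext i j <;> fin_cases i <;> fin_cases j <;> simp [gam] <;> norm_num
  have h22 : !![0, 0; 0, 1] ∈ R := by
    convert sub_mem R.one_mem h11 using 1
    ext i j <;> fin_cases i <;> fin_cases j <;> simp
  have h12 : !![0, 1; 0, 0] ∈ R := by
    convert mul_mem h11 (hg ![0, 1, 0, 0]) using 1
    ext i j <;> fin_cases i <;> fin_cases j <;> simp [gam]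
  have h21 : !![0, 0; 1, 0] ∈ R := by
    convert mul_mem h22 (hg ![0, -1, 0, 0]) using 1
    ext i j <;> fin_cases i <;> fin_cases j <;> simp [gam]
  have hσ : !![0, 1; 1, 0] ∈ R := by
    convert add_mem h12 h21 using 1
    ext i j <;> fin_cases i <;> fin_cases j <;> simp
  have hi : !![(mkq 0 1 0 0), 0; 0, mkq 0 1 0 0] ∈ R := by
    convert mul_mem hσ (hg ![0, 0, 1, 0]) using 1
    ext i j <;> fin_cases i <;> fin_cases j <;> simp [gam]
  have hj : !![(mkq 0 0 1 0), 0; 0, mkq 0 0 1 0] ∈ R := by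
    convert mul_mem hσ (hg ![0, 0, 0, 1]) using 1
    ext i j <;> fin_cases i <;> fin_cases j <;> simp [gam]
  have hk : !![(mkq 0 0 0 1), 0; 0, mkq 0 0 0 1] ∈ R := by
    convert mul_mem hi hj using 1
    ext i j <;> fin_cases i <;> fin_cases j <;> simp
  have hq : ∀ q : ℍ[ℝ], !![q, 0; 0, q] ∈ R := by
    intro q
    convert add_mem (add_mem (add_mem (R.smul_mem R.one_mem q.re) (R.smul_mem hi q.imI))
      (R.smul_mem hj q.imJ)) (R.smul_mem hk q.imK) using 1
    ext i j <;> fin_cases i <;> fin_cases j <;> simp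
  convert add_mem (add_mem (mul_mem h11 (hq (M 0 0))) (mul_mem h12 (hq (M 0 1))))
    (add_mem (mul_mem h21 (hq (M 1 0))) (mul_mem h22 (hq (M 1 1)))) using 1
  ext i j <;> fin_cases i <;> fin_cases j <;> simp

lemma φ_bij : Function.Bijective φ := by
  obtain ⟨hf, hd⟩ := S_dim
  rw [S_top] at hf hd
  have hf' : FiniteDimensional ℝ (CliffordAlgebra Q13) := Module.finite_def.2
    ((Submodule.fg_top _).1 (Module.finite_def.1 hf))
  rw [finrank_top] at hd
  have hM : Module.finrank ℝ (Matrix (Fin 2) (Fin 2) ℍ[ℝ]) = 16 := by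
    rw [Module.finrank_matrix, Quaternion.finrank_eq_four]; simp
  have hle := LinearMap.finrank_le_finrank_of_surjective (f := φ.toLinearMap) φ_surj
  have heq : Module.finrank ℝ (CliffordAlgebra Q13) =
      Module.finrank ℝ (Matrix (Fin 2) (Fin 2) ℍ[ℝ]) := by omega
  exact ⟨(LinearMap.injective_iff_surjective_of_finrank_eq_finrank
    (f := φ.toLinearMap) heq).2 φ_surj, φ_surj⟩

end SpacetimeAux

/-- The spacetime algebra `Cl(1,3)` is isomorphic as an `ℝ`-algebra to the algebra of
`2×2` matrices over the quaternions. -/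
theorem spacetime_iso_matrix_quaternion :
    Nonempty (CliffordAlgebra Q13 ≃ₐ[ℝ] Matrix (Fin 2) (Fin 2) (Quaternion ℝ)) := by
  exact ⟨AlgEquiv.ofBijective SpacetimeAux.φ SpacetimeAux.φ_bij⟩
end

section
/- Let h ∈ Matrix (Fin 4) (Fin 4) ℝ be an invertible matrix, let η = diag(1,−1,−1,−1), and set g := hᵀ * η * h (which is invertible and symmetric). Define for each μ ∈ Fin 4 the matrices q_μ := Σₐ h a μ • σₐ and q̌_μ := Σₐ h a μ • σ̌ₐ in Matrix (Fin 2) (Fin 2) ℂ. Then Σ_{μ,ν} (g⁻¹) μ ν • (q_μ * q̌_ν) = −4·σ₀; i.e., the contraction q^μ q̌_μ of the paravector fields with the inverse metric equals −4 times the identity. -/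
/-- The Pauli matrix `σ₀` (the `2×2` identity). -/
def s0 : Matrix (Fin 2) (Fin 2) ℂ := 1

/-- The Pauli matrix `σ₁`. -/
def s1 : Matrix (Fin 2) (Fin 2) ℂ := !![0, 1; 1, 0]

/-- The Pauli matrix `σ₂`. -/
def s2 : Matrix (Fin 2) (Fin 2) ℂ := !![0, -Complex.I; Complex.I, 0]

/-- The Pauli matrix `σ₃`. -/
def s3 : Matrix (Fin 2) (Fin 2) ℂ := !![1, 0; 0, -1]

/-- The indexed family `σₐ`, `a = 0,1,2,3`. -/
def sv : Fin 4 → Matrix (Fin 2) (Fin 2) ℂ := ![s0, s1, s2, s3]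

/-- The family `σ̌ₐ`, with `σ̌₀ = −σ₀` and `σ̌ⱼ = σⱼ` for `j = 1,2,3`. -/
def svc : Fin 4 → Matrix (Fin 2) (Fin 2) ℂ := ![-s0, s1, s2, s3]

/-- The Minkowski matrix `η = diag(1,−1,−1,−1)` as a `4×4` real matrix. -/
def etaM : Matrix (Fin 4) (Fin 4) ℝ := Matrix.diagonal ![1, -1, -1, -1]

theorem etaM_mul_self : etaM * etaM = 1 := by
  unfold etaM
  rw [Matrix.diagonal_mul_diagonal, ← Matrix.diagonal_one]
  congr 1
  funext i
  fin_cases i <;> simp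

theorem tetrad_inverse (h : Matrix (Fin 4) (Fin 4) ℝ) (hh : IsUnit h) :
    h * (h.transpose * etaM * h)⁻¹ * h.transpose = etaM := by
  have hd : IsUnit h.det := (Matrix.isUnit_iff_isUnit_det h).1 hh
  have hdt : IsUnit h.transpose.det := by rwa [Matrix.det_transpose]
  have he : etaM⁻¹ = etaM := Matrix.inv_eq_right_inv etaM_mul_self
  rw [Matrix.mul_inv_rev, Matrix.mul_inv_rev, he, Matrix.mul_nonsing_inv_cancel_left _ _ hd,
    Matrix.nonsing_inv_mul_cancel_right _ _ hdt]

theorem contraction_rearrange (h G : Matrix (Fin 4) (Fin 4) ℝ)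
    (s t : Fin 4 → Matrix (Fin 2) (Fin 2) ℂ) :
    ∑ μ : Fin 4, ∑ ν : Fin 4, (G μ ν) • ((∑ a, h a μ • s a) * (∑ a, h a ν • t a)) =
      ∑ a, ∑ b, (h * G * h.transpose) a b • (s a * t b) := by
  have e1 : ∀ μ ν, (G μ ν) • ((∑ a, h a μ • s a) * (∑ a, h a ν • t a)) =
      ∑ a, ∑ b, (h a μ * G μ ν * h b ν) • (s a * t b) := by
    intro μ ν
    rw [Finset.sum_mul_sum, Finset.smul_sum]
    refine Finset.sum_congr rfl fun a _ => ?_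
    rw [Finset.smul_sum]
    refine Finset.sum_congr rfl fun b _ => ?_
    rw [smul_mul_smul_comm, smul_smul]
    congr 1
    ring
  have e2 : ∀ a b, (h * G * h.transpose) a b • (s a * t b) =
      ∑ ν, ∑ μ, (h a μ * G μ ν * h b ν) • (s a * t b) := by
    intro a b
    simp only [Matrix.mul_apply, Matrix.transpose_apply, Finset.sum_mul, Finset.sum_smul]
  simp only [e1, e2]
  rw [Finset.sum_comm]
  refine (Finset.sum_congr rfl fun ν _ => Finset.sum_comm).trans ?_
  refine Finset.sum_comm.trans ?_
  refine Finset.sum_congr rfl fun a _ => ?_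
  refine (Finset.sum_congr rfl fun ν _ => Finset.sum_comm).trans ?_
  exact Finset.sum_comm

/-- For an invertible tetrad matrix `h` with metric `g = hᵀ η h`, the contraction of
the paravector fields `q_μ = Σₐ h a μ • σₐ` and `q̌_ν = Σₐ h a ν • σ̌ₐ` with the inverse
metric satisfies `g^{μν} q_μ q̌_ν = −4 σ₀`. -/
theorem paravector_full_contraction (h : Matrix (Fin 4) (Fin 4) ℝ) (hh : IsUnit h) :
    ∑ μ : Fin 4, ∑ ν : Fin 4,
        ((h.transpose * etaM * h)⁻¹ μ ν) • ((∑ a, h a μ • sv a) * (∑ a, h a ν • svc a)) =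
      (-4 : ℝ) • s0 := by
  rw [contraction_rearrange, tetrad_inverse h hh]
  ext i j
  fin_cases i <;> fin_cases j <;>
    simp [Fin.sum_univ_four, etaM, sv, svc, s0, s1, s2, s3, Matrix.diagonal_apply] <;> norm_num
end
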